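/- In a side-out A-game with score (α,β) and B scoring last, the conditional moment generating function of the number of rallies D is M(t) = ((1-q)e^t / (1 - q e^{2t}))^{α+β} · E[e^{t(2R-1)}], where R takes value r ∈ {1, …, min(α,β-1)+1} with probability proportional to C(α,r-1) C(β-1,r-1) q^{r-1}, and q = (1-p_a)(1-p_b), valid for q e^{2t} < 1. -/

import Mathlib

open scoped BigOperators
open Filter

/-- Side-out scoring: a trajectory is the list of rally outcomes, `true` meaning that the
current server wins the rally.  `soScorers srv g` is the list of scorers (`true` = player A),
where `srv` is the current server. -/
def soScorers : Bool → List Bool → List Bool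
  | _, [] => []
  | srv, s :: rest => (if s then [srv] else []) ++ soScorers (if s then srv else !srv) rest

/-- Probability weight of a trajectory of rally outcomes: the server wins a rally with
probability `pa` (if A serves) or `pb` (if B serves); rallies are independent. -/
def soWeight (pa pb : ℝ) : Bool → List Bool → ℝ
  | _, [] => 1
  | srv, s :: rest =>
      (if srv then (if s then pa else 1 - pa) else (if s then pb else 1 - pb)) *
        soWeight pa pb (if s then srv else !srv) rest

/-- Points scored by player A (first server A). -/
def soScoreA (g : List Bool) : ℕ := (soScorers true g).count true

/-- Points scored by player B (first server A). -/
def soScoreB (g : List Bool) : ℕ := (soScorers true g).count false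

/-- The trajectory ends with a rally in which A scores a point. -/
def soLastA (g : List Bool) : Prop :=
  g.getLast? = some true ∧ (soScorers true g).getLast? = some true

/-- The trajectory ends with a rally in which B scores a point. -/
def soLastB (g : List Bool) : Prop :=
  g.getLast? = some true ∧ (soScorers true g).getLast? = some false

/-- Number of maximal runs of `false` in a list, the first argument being the previous value. -/
def falseRuns : Bool → List Bool → ℕ
  | _, [] => 0
  | prev, b :: rest => (if prev && !b then 1 else 0) + falseRuns b rest

/-- Number of A-interruptions: maximal stretches in which B gains the serve from A and
scores at least one point, i.e. maximal blocks of points scored by B. -/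
def soInter (g : List Bool) : ℕ := falseRuns true (soScorers true g)

/-- Number of exchanges: pairs of consecutive rallies in which a player gains the right to
serve and immediately loses it without scoring. -/
def exchCount : List Bool → ℕ
  | [] => 0
  | true :: rest => exchCount rest
  | [false] => 0
  | false :: true :: rest => exchCount rest
  | false :: false :: rest => 1 + exchCount rest

/-- Probability of a set of trajectories in the side-out model, first server A. -/
noncomputable def soPr (pa pb : ℝ) (E : Set (List Bool)) : ℝ :=
  ∑' g : List Bool, Set.indicator E (soWeight pa pb true) g

/-- Conditional expectation of `f` given the event `E` in the side-out model, first server A. -/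
noncomputable def soCondExp (pa pb : ℝ) (E : Set (List Bool)) (f : List Bool → ℝ) : ℝ :=
  (∑' g : List Bool, Set.indicator E (fun g => soWeight pa pb true g * f g) g) / soPr pa pb E

/-- Trajectories, first server `s`, in which A scores `a` points, B scores `b` points, and which
stop as soon as the last of these points is scored; this last scorer (or `s`, if nobody scores)
is B. -/
def soEndB (s : Bool) (a b : ℕ) : Set (List Bool) :=
  {g | (soScorers s g).count true = a ∧ (soScorers s g).count false = b ∧
    (true :: g).getLast? = some true ∧ (s :: soScorers s g).getLast? = some false}

/-- The weight `soWeight` tilted by `x ^ length` and restricted to `soEndB`. -/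
noncomputable def soTilt (pa pb x : ℝ) (s : Bool) (a b : ℕ) : List Bool → ℝ :=
  (soEndB s a b).indicator fun g => soWeight pa pb s g * x ^ g.length

/-- Generating polynomial, by pairs of changes of server, of the scorer sequences with `a` points
for A and `b` points for B that end with B, the first server being `s`. -/
noncomputable def scorerPoly (Q : ℝ) : Bool → ℕ → ℕ → ℝ
  | true, _, 0 => 0
  | true, a, b + 1 => ∑ k ∈ Finset.range (a + 1), (a.choose k : ℝ) * (b.choose k : ℝ) * Q ^ k
  | false, 0, _ => 1
  | false, a + 1, b =>
      ∑ k ∈ Finset.range (a + 1), (a.choose k : ℝ) * (b.choose (k + 1) : ℝ) * Q ^ (k + 1)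

lemma scorerPoly_true_zero_succ (Q : ℝ) (b : ℕ) : scorerPoly Q true 0 (b + 1) = 1 := by
  simp [scorerPoly]

lemma scorerPoly_false_zero (Q : ℝ) (b : ℕ) : scorerPoly Q false 0 b = 1 := by
  simp [scorerPoly]

lemma scorerPoly_true_zero (Q : ℝ) (a : ℕ) : scorerPoly Q true a 0 = 0 := by
  simp [scorerPoly]

lemma scorerPoly_false_succ_zero (Q : ℝ) (a : ℕ) : scorerPoly Q false (a + 1) 0 = 0 := by
  simp [scorerPoly]

lemma scorerPoly_true_succ_succ (Q : ℝ) (a b : ℕ) :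
    scorerPoly Q true (a + 1) (b + 1) =
      scorerPoly Q true a (b + 1) + scorerPoly Q false (a + 1) b := by
  simp only [scorerPoly]
  have h : ∑ k ∈ Finset.range (a + 1), (a.choose k : ℝ) * (b.choose k : ℝ) * Q ^ k =
      ∑ k ∈ Finset.range (a + 1 + 1), (a.choose k : ℝ) * (b.choose k : ℝ) * Q ^ k := by
    rw [Finset.sum_range_succ _ (a + 1)]
    simp
  rw [h, Finset.sum_range_succ', Finset.sum_range_succ' _ (a + 1), add_right_comm,
    ← Finset.sum_add_distrib]
  congr 1
  · refine Finset.sum_congr rfl fun k _ => ?_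
    rw [Nat.choose_succ_succ]
    push_cast
    ring
  · simp

lemma scorerPoly_false_succ_succ (Q : ℝ) (a b : ℕ) :
    scorerPoly Q false (a + 1) (b + 1) =
      scorerPoly Q false (a + 1) b + Q * scorerPoly Q true a (b + 1) := by
  simp only [scorerPoly]
  rw [Finset.mul_sum, ← Finset.sum_add_distrib]
  refine Finset.sum_congr rfl fun k _ => ?_
  rw [Nat.choose_succ_succ b k]
  push_cast
  ring

section Trajectories

variable {pa pb x : ℝ}

lemma soTilt_nonneg (hpa0 : 0 ≤ pa) (hpa1 : pa ≤ 1) (hpb0 : 0 ≤ pb) (hpb1 : pb ≤ 1)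
    (hx : 0 ≤ x) (s : Bool) (a b : ℕ) (g : List Bool) : 0 ≤ soTilt pa pb x s a b g := by
  have hw : 0 ≤ soWeight pa pb s g := by
    induction g generalizing s with
    | nil => simp [soWeight]
    | cons c g ih =>
      rw [soWeight]
      refine mul_nonneg ?_ (ih _)
      split_ifs <;> linarith
  exact Set.indicator_apply_nonneg fun _ => mul_nonneg hw (by positivity)

lemma soScorers_ne_nil (s : Bool) {g : List Bool} (hg : true ∈ g) : soScorers s g ≠ [] := by
  induction g generalizing s with
  | nil => simp at hg
  | cons c g ih =>
    cases c with
    | true => simp [soScorers]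
    | false => simpa [soScorers] using ih (!s) (by simpa using hg)

lemma soTilt_false_cons (s : Bool) (a b : ℕ) {g : List Bool} (hg : g ≠ []) :
    soTilt pa pb x s a b (false :: g) =
      (if s then 1 - pa else 1 - pb) * x * soTilt pa pb x (!s) a b g := by
  obtain ⟨c, g, rfl⟩ := List.exists_cons_of_ne_nil hg
  have h : false :: c :: g ∈ soEndB s a b ↔ c :: g ∈ soEndB (!s) a b := by
    have hL : (c :: g).getLast? = some true → ∀ s', (s' :: soScorers (!s) (c :: g)).getLast? =
        (soScorers (!s) (c :: g)).getLast? := by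
      intro hlast s'
      exact List.getLast?_cons_of_ne_nil (soScorers_ne_nil _ (List.mem_of_getLast? hlast))
    have hs : soScorers s (false :: c :: g) = soScorers (!s) (c :: g) := rfl
    simp only [soEndB, Set.mem_ofPred_eq, hs, List.getLast?_cons_cons]
    refine and_congr_right fun _ => and_congr_right fun _ => and_congr_right fun hlast => ?_
    rw [hL hlast, hL hlast]
  by_cases hg : c :: g ∈ soEndB (!s) a b
  · rw [soTilt, soTilt, Set.indicator_of_mem hg, Set.indicator_of_mem (h.2 hg)]
    simp only [soWeight, List.length_cons]
    split_ifs <;> simp_all <;> ring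
  · rw [soTilt, soTilt, Set.indicator_of_notMem hg, Set.indicator_of_notMem (mt h.1 hg), mul_zero]

lemma soTilt_true_cons_A (a b : ℕ) (g : List Bool) :
    soTilt pa pb x true (a + 1) b (true :: g) = pa * x * soTilt pa pb x true a b g := by
  have h : true :: g ∈ soEndB true (a + 1) b ↔ g ∈ soEndB true a b := by
    simp [soEndB, soScorers, List.getLast?_cons_cons]
  by_cases hg : g ∈ soEndB true a b
  · rw [soTilt, soTilt, Set.indicator_of_mem hg, Set.indicator_of_mem (h.2 hg)]
    simp [soWeight]
    ring
  · rw [soTilt, soTilt, Set.indicator_of_notMem hg, Set.indicator_of_notMem (mt h.1 hg), mul_zero]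

lemma soTilt_true_cons_B (a b : ℕ) (g : List Bool) :
    soTilt pa pb x false a (b + 1) (true :: g) = pb * x * soTilt pa pb x false a b g := by
  have h : true :: g ∈ soEndB false a (b + 1) ↔ g ∈ soEndB false a b := by
    simp [soEndB, soScorers, List.getLast?_cons_cons]
  by_cases hg : g ∈ soEndB false a b
  · rw [soTilt, soTilt, Set.indicator_of_mem hg, Set.indicator_of_mem (h.2 hg)]
    simp [soWeight]
    ring
  · rw [soTilt, soTilt, Set.indicator_of_notMem hg, Set.indicator_of_notMem (mt h.1 hg), mul_zero]

lemma soTilt_true_cons_A_zero (b : ℕ) (g : List Bool) :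
    soTilt pa pb x true 0 b (true :: g) = 0 := by
  refine Set.indicator_of_notMem ?_ _
  simp [soEndB, soScorers]

lemma soTilt_true_cons_B_zero (a : ℕ) (g : List Bool) :
    soTilt pa pb x false a 0 (true :: g) = 0 := by
  refine Set.indicator_of_notMem ?_ _
  simp [soEndB, soScorers]

lemma soTilt_replicate (s : Bool) (a b m : ℕ) (g : List Bool) :
    soTilt pa pb x s a b (List.replicate (2 * m) false ++ true :: g) =
      ((1 - pa) * (1 - pb) * x ^ 2) ^ m * soTilt pa pb x s a b (true :: g) := by
  induction m with
  | zero => simp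
  | succ m ih =>
    rw [show 2 * (m + 1) = 2 * m + 1 + 1 by ring, List.replicate_succ, List.replicate_succ,
      List.cons_append, List.cons_append, soTilt_false_cons _ _ _ (by simp),
      soTilt_false_cons _ _ _ (by simp), Bool.not_not, ih, pow_succ]
    cases s <;> simp <;> ring

lemma exists_replicate_false_append {g : List Bool} (hg : true ∈ g) :
    ∃ k g', g = List.replicate k false ++ true :: g' := by
  induction g with
  | nil => simp at hg
  | cons c g ih =>
    cases c with
    | true => exact ⟨0, g, rfl⟩
    | false =>
      obtain ⟨k, g', h⟩ := ih (by simpa using hg)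
      exact ⟨k + 1, g', by rw [h, List.replicate_succ, List.cons_append]⟩

lemma replicate_false_append_inj {k l : ℕ} {g g' : List Bool}
    (h : List.replicate k false ++ true :: g = List.replicate l false ++ true :: g') :
    k = l ∧ g = g' := by
  induction k generalizing l with
  | zero => cases l <;> simp_all [List.replicate_succ]
  | succ k ih =>
    cases l with
    | zero => simp [List.replicate_succ] at h
    | succ l =>
      simp only [List.replicate_succ, List.cons_append, List.cons.injEq, true_and] at h
      exact (ih h).imp_left (congrArg _)

lemma true_mem_of_soTilt_ne_zero {s : Bool} {a b : ℕ} {g : List Bool}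
    (h : soTilt pa pb x s a b g ≠ 0) (hg : g ≠ []) : true ∈ g := by
  have hmem := Set.mem_of_indicator_ne_zero h
  obtain ⟨c, g, rfl⟩ := List.exists_cons_of_ne_nil hg
  have := hmem.2.2.1
  rw [List.getLast?_cons_cons] at this
  exact List.mem_of_getLast? this

lemma hasSum_soTilt_of_true_cons (hpa0 : 0 ≤ pa) (hpa1 : pa ≤ 1) (hpb0 : 0 ≤ pb) (hpb1 : pb ≤ 1)
    (hx : 0 ≤ x) (hQ : (1 - pa) * (1 - pb) * x ^ 2 < 1) {s : Bool} {a b : ℕ}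
    (hab : a ≠ 0 ∨ b ≠ 0) {u v : ℝ}
    (hu : HasSum (fun g => soTilt pa pb x s a b (true :: g)) u)
    (hv : HasSum (fun g => soTilt pa pb x (!s) a b (true :: g)) v) :
    HasSum (soTilt pa pb x s a b) ((1 - (1 - pa) * (1 - pb) * x ^ 2)⁻¹ *
      (u + (if s then 1 - pa else 1 - pb) * x * v)) := by
  have hpa : 0 ≤ 1 - pa := by linarith
  have hpb : 0 ≤ 1 - pb := by linarith
  have hQ0 : 0 ≤ (1 - pa) * (1 - pb) * x ^ 2 := by positivity
  have hgeom := hasSum_geometric_of_lt_one hQ0 hQ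
  have hodd (m : ℕ) (g : List Bool) :
      soTilt pa pb x s a b (List.replicate (2 * m + 1) false ++ true :: g) =
        ((1 - pa) * (1 - pb) * x ^ 2) ^ m * ((if s then 1 - pa else 1 - pb) * x *
          soTilt pa pb x (!s) a b (true :: g)) := by
    rw [List.replicate_succ, List.cons_append, soTilt_false_cons _ _ _ (by simp),
      soTilt_replicate]
    ring
  have hmul {w : List Bool → ℝ} {c : ℝ} (hw : HasSum w c) (hw0 : ∀ g, 0 ≤ w g) :
      HasSum (fun y : ℕ × List Bool => ((1 - pa) * (1 - pb) * x ^ 2) ^ y.1 * w y.2)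
        ((1 - (1 - pa) * (1 - pb) * x ^ 2)⁻¹ * c) :=
    hgeom.mul hw (hgeom.summable.mul_of_nonneg hw.summable (fun m => pow_nonneg hQ0 m) hw0)
  let φ : (ℕ × List Bool) ⊕ (ℕ × List Bool) → List Bool :=
    Sum.elim (fun y => List.replicate (2 * y.1) false ++ true :: y.2)
      (fun y => List.replicate (2 * y.1 + 1) false ++ true :: y.2)
  have hφ : Function.Injective φ := by
    rintro (⟨m, g⟩ | ⟨m, g⟩) (⟨m', g'⟩ | ⟨m', g'⟩) h <;>
      obtain ⟨h1, h2⟩ := replicate_false_append_inj h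
    · simp only [Sum.inl.injEq, Prod.mk.injEq]
      exact ⟨by omega, h2⟩
    · omega
    · omega
    · simp only [Sum.inr.injEq, Prod.mk.injEq]
      exact ⟨by omega, h2⟩
  have hrange : ∀ g ∉ Set.range φ, soTilt pa pb x s a b g = 0 := by
    intro g hg
    by_contra hne
    have hnil : g ≠ [] := by
      rintro rfl
      have hmem := Set.mem_of_indicator_ne_zero hne
      rcases hab with h | h
      · exact h hmem.1.symm
      · exact h hmem.2.1.symm
    obtain ⟨k, g', rfl⟩ := exists_replicate_false_append (true_mem_of_soTilt_ne_zero hne hnil)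
    obtain ⟨m, rfl | rfl⟩ := Nat.even_or_odd' k
    · exact hg ⟨Sum.inl (m, g'), rfl⟩
    · exact hg ⟨Sum.inr (m, g'), rfl⟩
  have hnn := soTilt_nonneg hpa0 hpa1 hpb0 hpb1 hx
  rw [← hφ.hasSum_iff hrange, mul_add]
  refine HasSum.sum ?_ ?_
  · convert hmul hu (fun g => hnn _ _ _ _) using 2 with y
    exact soTilt_replicate _ _ _ _ _
  · convert hmul (hv.mul_left ((if s then 1 - pa else 1 - pb) * x))
      (fun g => mul_nonneg (by split_ifs <;> positivity) (hnn _ _ _ _)) using 2 with y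
    exact hodd _ _

lemma soTilt_zero_zero (s : Bool) (g : List Bool) (hg : g ≠ []) :
    soTilt pa pb x s 0 0 g = 0 := by
  by_contra hne
  obtain ⟨k, g, rfl⟩ := exists_replicate_false_append (true_mem_of_soTilt_ne_zero hne hg)
  clear hg
  induction k generalizing s with
  | zero =>
    cases s
    · exact hne (soTilt_true_cons_B_zero _ _)
    · exact hne (soTilt_true_cons_A_zero _ _)
  | succ k ih =>
    rw [List.replicate_succ, List.cons_append, soTilt_false_cons _ _ _ (by simp)] at hne
    exact ih _ (right_ne_zero_of_mul hne)

lemma hasSum_soTilt (hpa0 : 0 ≤ pa) (hpa1 : pa ≤ 1) (hpb0 : 0 ≤ pb) (hpb1 : pb ≤ 1)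
    (hx : 0 ≤ x) (hQ : (1 - pa) * (1 - pb) * x ^ 2 < 1) (s : Bool) (a b : ℕ) :
    HasSum (soTilt pa pb x s a b)
      (((1 - (1 - pa) * (1 - pb) * x ^ 2)⁻¹) ^ (a + b) * (pa * x) ^ a * (pb * x) ^ b *
        ((if s then (1 - pa) * x else 1) * scorerPoly ((1 - pa) * (1 - pb) * x ^ 2) s a b)) := by
  induction hn : a + b generalizing s a b with
  | zero =>
    obtain ⟨rfl, rfl⟩ : a = 0 ∧ b = 0 := by omega
    convert hasSum_single (f := soTilt pa pb x s 0 0) [] (soTilt_zero_zero s) using 1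
    cases s <;> simp [scorerPoly, soTilt, soEndB, soScorers, soWeight, Set.indicator]
  | succ n ih =>
    have step := fun u v => hasSum_soTilt_of_true_cons (u := u) (v := v) (s := s) (a := a) (b := b)
      hpa0 hpa1 hpb0 hpb1 hx hQ (by omega)
    have hA (a' : ℕ) (h : a = a' + 1) := (ih true a' b (by omega)).mul_left (pa * x)
    have hB (b' : ℕ) (h : b = b' + 1) := (ih false a b' (by omega)).mul_left (pb * x)
    simp only [← soTilt_true_cons_A] at hA
    simp only [← soTilt_true_cons_B] at hB
    have hA0 : HasSum (fun g => soTilt pa pb x true 0 b (true :: g)) 0 := by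
      simp only [soTilt_true_cons_A_zero]; exact hasSum_zero
    have hB0 : HasSum (fun g => soTilt pa pb x false a 0 (true :: g)) 0 := by
      simp only [soTilt_true_cons_B_zero]; exact hasSum_zero
    generalize (1 - (1 - pa) * (1 - pb) * x ^ 2)⁻¹ = Z at *
    rcases a with _ | a <;> rcases b with _ | b
    · omega
    · specialize hB b rfl
      cases s
      · convert step _ _ hB hA0 using 1
        simp [scorerPoly_false_zero]; ring
      · convert step _ _ hA0 hB using 1
        simp [scorerPoly_false_zero, scorerPoly_true_zero_succ]; ring
    · specialize hA a rfl
      cases s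
      · convert step _ _ hB0 hA using 1
        simp [scorerPoly_false_succ_zero, scorerPoly_true_zero]
      · convert step _ _ hA hB0 using 1
        simp [scorerPoly_true_zero]
    · specialize hA a rfl
      specialize hB b rfl
      cases s
      · convert step _ _ hB hA using 1
        simp [scorerPoly_false_succ_succ]; ring
      · convert step _ _ hA hB using 1
        simp [scorerPoly_true_succ_succ]; ring

end Trajectories

lemma setOf_soLastB_eq_soEndB (α β : ℕ) :
    {g : List Bool | soScoreA g = α ∧ soScoreB g = β ∧ soLastB g} = soEndB true α β := by
  ext g
  have h1 : (true :: soScorers true g).getLast? = some false ↔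
      (soScorers true g).getLast? = some false := by
    cases soScorers true g <;> simp [List.getLast?_cons_cons]
  simp only [soEndB, soScoreA, soScoreB, soLastB, Set.mem_ofPred_eq, h1]
  cases g with
  | nil => simp [soScorers]
  | cons c g => rw [List.getLast?_cons_cons]

lemma scorerPoly_true_succ_eq_sum_Icc (Q : ℝ) (a b : ℕ) :
    scorerPoly Q true a (b + 1) = ∑ r ∈ Finset.Icc 1 (min a b + 1),
      (a.choose (r - 1) : ℝ) * (b.choose (r - 1) : ℝ) * Q ^ (r - 1) := by
  rw [← Finset.Ico_add_one_right_eq_Icc, Finset.sum_Ico_eq_sum_range, scorerPoly]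
  simp only [Nat.add_sub_cancel_left, Nat.add_sub_cancel]
  refine (Finset.sum_subset (by simp) fun k _ hk => ?_).symm
  rw [Finset.mem_range, not_lt, Nat.succ_le_iff, min_lt_iff] at hk
  rcases hk with h | h <;> simp [Nat.choose_eq_zero_of_lt h]

theorem stmt_5 (α β : ℕ) (hβ : 1 ≤ β) (pa pb : ℝ) (hpa0 : 0 < pa) (hpa1 : pa < 1)
    (hpb0 : 0 < pb) (hpb1 : pb < 1) (t : ℝ)
    (ht : (1 - pa) * (1 - pb) * Real.exp (2 * t) < 1) :
    soCondExp pa pb {g : List Bool | soScoreA g = α ∧ soScoreB g = β ∧ soLastB g}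
        (fun g => Real.exp (t * (g.length : ℝ))) =
      ((1 - (1 - pa) * (1 - pb)) * Real.exp t /
          (1 - (1 - pa) * (1 - pb) * Real.exp (2 * t))) ^ (α + β) *
        ((∑ r ∈ Finset.Icc 1 (min α (β - 1) + 1),
            Real.exp (t * (2 * (r : ℝ) - 1)) *
              ((α.choose (r - 1) : ℝ) * ((β - 1).choose (r - 1) : ℝ) *
                ((1 - pa) * (1 - pb)) ^ (r - 1))) /
          (∑ r ∈ Finset.Icc 1 (min α (β - 1) + 1),
            (α.choose (r - 1) : ℝ) * ((β - 1).choose (r - 1) : ℝ) *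
              ((1 - pa) * (1 - pb)) ^ (r - 1))) := by
  obtain ⟨b, rfl⟩ : ∃ b, β = b + 1 := ⟨β - 1, by omega⟩
  have hx2 : Real.exp (2 * t) = Real.exp t ^ 2 := by rw [← Real.exp_nat_mul]; norm_num
  have hq0 : 0 < (1 - pa) * (1 - pb) := mul_pos (by linarith) (by linarith)
  have hq1 : (1 - pa) * (1 - pb) < 1 := by nlinarith
  have hden := hasSum_soTilt (x := 1) hpa0.le hpa1.le hpb0.le hpb1.le zero_le_one
    (by simpa using hq1) true α (b + 1)
  have hnum := hasSum_soTilt (x := Real.exp t) hpa0.le hpa1.le hpb0.le hpb1.le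
    (Real.exp_pos t).le (by rwa [← hx2]) true α (b + 1)
  have hterm (r : ℕ) (hr : r ∈ Finset.Icc 1 (min α (b + 1 - 1) + 1)) :
      Real.exp (t * (2 * (r : ℝ) - 1)) *
        ((α.choose (r - 1) : ℝ) * ((b + 1 - 1).choose (r - 1) : ℝ) *
          ((1 - pa) * (1 - pb)) ^ (r - 1)) =
      Real.exp t * ((α.choose (r - 1) : ℝ) * (b.choose (r - 1) : ℝ) *
          ((1 - pa) * (1 - pb) * Real.exp t ^ 2) ^ (r - 1)) := by
    obtain ⟨k, rfl⟩ : ∃ k, r = k + 1 := ⟨r - 1, by have := Finset.mem_Icc.1 hr; omega⟩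
    have : Real.exp (t * (2 * ((k + 1 : ℕ) : ℝ) - 1)) = Real.exp t * (Real.exp t ^ 2) ^ k := by
      rw [← hx2, ← Real.exp_nat_mul, ← Real.exp_add]
      push_cast
      ring_nf
    rw [this, mul_pow _ (Real.exp t ^ 2)]
    simp only [Nat.add_sub_cancel]
    ring
  rw [Finset.sum_congr rfl hterm, ← Finset.mul_sum]
  simp only [Nat.add_sub_cancel]
  rw [← scorerPoly_true_succ_eq_sum_Icc, ← scorerPoly_true_succ_eq_sum_Icc]
  have hpos : 0 < scorerPoly ((1 - pa) * (1 - pb)) true α (b + 1) := by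
    rw [scorerPoly, Finset.sum_range_succ']
    exact add_pos_of_nonneg_of_pos (Finset.sum_nonneg fun k _ => by positivity) (by simp)
  rw [soCondExp, soPr, setOf_soLastB_eq_soEndB]
  have hden' := hden.tsum_eq
  have hnum' := hnum.tsum_eq
  simp only [soTilt, one_pow, mul_one, if_true] at hden' hnum'
  simp only [mul_comm t, Real.exp_nat_mul]
  rw [hden', hnum', hx2]
  have h1 : 1 - pa ≠ 0 := by linarith
  have h2 : 1 - (1 - pa) * (1 - pb) ≠ 0 := by linarith
  have h3 : 1 - (1 - pa) * (1 - pb) * Real.exp t ^ 2 ≠ 0 := by rw [← hx2]; linarith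
  generalize scorerPoly ((1 - pa) * (1 - pb)) true α (b + 1) = S at *
  generalize scorerPoly ((1 - pa) * (1 - pb) * Real.exp t ^ 2) true α (b + 1) = T at *
  generalize 1 - (1 - pa) * (1 - pb) * Real.exp t ^ 2 = Z at *
  generalize 1 - (1 - pa) * (1 - pb) = Y at *
  have hS := hpos.ne'
  have hpa := hpa0.ne'
  have hpb := hpb0.ne'
  simp only [div_pow, mul_pow, inv_pow]
  field_simp
  ring
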